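/- There exists an integer n⋆(ε) such that N_n ≥ (1−ε)³ n^{(2+2ε)/3} for all integers n ≥ n⋆(ε). -/

import Mathlib

noncomputable section

namespace CubePacking

/-- The side lengths `ℓ_k := k^{−(1+ε)/3}`. -/
def sideLen (ε : ℝ) (k : ℕ) : ℝ := (k : ℝ) ^ (-(1 + ε) / 3)

/-- `L_n^m := ∑_{k=n}^m ℓ_k`, the length needed to put the cubes `n,…,m` in a row. -/
def L (ε : ℝ) (n m : ℕ) : ℝ := ∑ k ∈ Finset.Icc n m, sideLen ε k

/-- `M_n := max{m ≥ n : L_n^m ≤ 1} − n + 1`, the number of cubes, starting from the `n`-th,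
fitting in a row of length `1`.  (The maximum exists for `n ≥ 1` since `ℓ_n ≤ 1` and
`L_n^m → ∞` as `m → ∞`; it is realized here by `sSup`, which coincides with the maximum
of a nonempty bounded-above set of naturals.) -/
def M (ε : ℝ) (n : ℕ) : ℕ := sSup {m : ℕ | n ≤ m ∧ L ε n m ≤ 1} - n + 1

/-- The index `B^n_r` of the first cube of the `r`-th row when rows are started at the `n`-th
cube: `B^n_1 := n` and `B^n_{r+1} := B^n_r + M_{B^n_r}` for `r ≥ 1`. -/
def B (ε : ℝ) (n : ℕ) : ℕ → ℕ
  | 0 => n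
  | 1 => n
  | r + 2 => B ε n (r + 1) + M ε (B ε n (r + 1))

/-- `W_n^R := ∑_{r=1}^R (B^n_r)^{−(1+ε)/3}`, the width occupied by `R` rows starting at the
`n`-th cube. -/
def W (ε : ℝ) (n R : ℕ) : ℝ := ∑ r ∈ Finset.Icc 1 R, (B ε n r : ℝ) ^ (-(1 + ε) / 3)

/-- `R_n := max{R ≥ 1 : W_n^R ≤ 1}`, the number of rows fitting in the unit square starting
from the `n`-th cube.  (Again the maximum is realized by `sSup`.) -/
def Rn (ε : ℝ) (n : ℕ) : ℕ := sSup {R : ℕ | 1 ≤ R ∧ W ε n R ≤ 1}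

/-- `N_n := B^n_{R_n+1} − n + 1`, the number of cubes in those rows. -/
def N (ε : ℝ) (n : ℕ) : ℕ := B ε n (Rn ε n + 1) - n + 1

/-- The index `S_l` of the cube starting the `l`-th vertical layer:
`S_1 := 1` and `S_{l+1} := S_l + N_{S_l}` for `l ≥ 1`. -/
def S (ε : ℝ) : ℕ → ℕ
  | 0 => 1
  | 1 => 1
  | l + 2 => S ε (l + 1) + N ε (S ε (l + 1))

/-- The height `H_l := S_l^{−(1+ε)/3}` of the `l`-th layer. -/
def H (ε : ℝ) (l : ℕ) : ℝ := (S ε l : ℝ) ^ (-(1 + ε) / 3)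

end CubePacking

namespace CubePacking

lemma inv_sqrt_le_sideLen {ε : ℝ} (hε : ε < 1 / 2) {k : ℕ} (hk : 1 ≤ k) :
    (√(k : ℝ))⁻¹ ≤ sideLen ε k := by
  have hk' : (1 : ℝ) ≤ k := by exact_mod_cast hk
  rw [Real.sqrt_eq_rpow, ← Real.rpow_neg (by positivity)]
  exact Real.rpow_le_rpow_of_exponent_le hk' (by linarith)

lemma sideLen_anti {ε : ℝ} (hε0 : 0 < ε) {n k : ℕ} (hn : 1 ≤ n) (hk : n ≤ k) :
    sideLen ε k ≤ sideLen ε n := by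
  have hn' : (0 : ℝ) < n := by exact_mod_cast hn
  exact Real.rpow_le_rpow_of_nonpos hn' (by exact_mod_cast hk) (by linarith)

/-- A segment of cubes that fits in a row of length `1` has at most `√m` cubes. -/
lemma card_le_sqrt_of_L_le_one {ε : ℝ} (hε : ε < 1 / 2) {n m : ℕ} (hn : 1 ≤ n) (hm : n ≤ m)
    (h : L ε n m ≤ 1) : (m : ℝ) + 1 - n ≤ √(m : ℝ) := by
  have hpos : 0 < √(m : ℝ) := Real.sqrt_pos.2 (by exact_mod_cast hn.trans hm)
  have hsum : (Finset.Icc n m).card • (√(m : ℝ))⁻¹ ≤ L ε n m := by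
    refine Finset.card_nsmul_le_sum _ _ _ fun k hk => ?_
    obtain ⟨h1, h2⟩ := Finset.mem_Icc.1 hk
    have hk1 : 1 ≤ k := hn.trans h1
    refine le_trans ?_ (inv_sqrt_le_sideLen hε hk1)
    have : 0 < √(k : ℝ) := Real.sqrt_pos.2 (by exact_mod_cast hk1)
    gcongr
  rw [Nat.card_Icc, nsmul_eq_mul, Nat.cast_sub (by omega)] at hsum
  have := hsum.trans h
  rw [← div_eq_mul_inv, div_le_one hpos] at this
  exact_mod_cast this

lemma bddAbove_row {ε : ℝ} (hε : ε < 1 / 2) {n : ℕ} (hn : 1 ≤ n) :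
    BddAbove {m : ℕ | n ≤ m ∧ L ε n m ≤ 1} := by
  refine ⟨2 * n, fun m hm => ?_⟩
  have h := card_le_sqrt_of_L_le_one hε hn hm.1 hm.2
  have hsq := Real.sq_sqrt (Nat.cast_nonneg (α := ℝ) m)
  have : (m : ℝ) ≤ 2 * n := by nlinarith [sq_nonneg (√(m : ℝ) - 1)]
  exact_mod_cast this

lemma L_le_one {ε : ℝ} (hε0 : 0 < ε) {n m : ℕ} (hn : 1 ≤ n) (hm : n ≤ m)
    (h : (m : ℝ) + 1 - n ≤ (n : ℝ) ^ ((1 + ε) / 3)) : L ε n m ≤ 1 := by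
  have hn' : (0 : ℝ) < n := by exact_mod_cast hn
  have hsum : L ε n m ≤ (Finset.Icc n m).card • sideLen ε n :=
    Finset.sum_le_card_nsmul _ _ _ fun k hk => sideLen_anti hε0 hn (Finset.mem_Icc.1 hk).1
  rw [Nat.card_Icc, nsmul_eq_mul, Nat.cast_sub (by omega)] at hsum
  refine hsum.trans ?_
  rw [sideLen, neg_div, Real.rpow_neg hn'.le, ← div_eq_mul_inv,
    div_le_one (Real.rpow_pos_of_pos hn' _)]
  exact_mod_cast h

lemma one_le_floor_rpow {ε : ℝ} (hε0 : 0 < ε) {n : ℕ} (hn : 1 ≤ n) :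
    1 ≤ ⌊(n : ℝ) ^ ((1 + ε) / 3)⌋₊ :=
  Nat.le_floor (by
    rw [Nat.cast_one]
    exact Real.one_le_rpow (by exact_mod_cast hn) (by linarith))

lemma floor_rpow_le_M {ε : ℝ} (hε0 : 0 < ε) (hε : ε < 1 / 2) {n : ℕ} (hn : 1 ≤ n) :
    ⌊(n : ℝ) ^ ((1 + ε) / 3)⌋₊ ≤ M ε n := by
  set f := ⌊(n : ℝ) ^ ((1 + ε) / 3)⌋₊ with hf
  have hf1 : 1 ≤ f := one_le_floor_rpow hε0 hn
  have hfle : (f : ℝ) ≤ (n : ℝ) ^ ((1 + ε) / 3) := Nat.floor_le (by positivity)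
  have hmem : n + f - 1 ∈ {m : ℕ | n ≤ m ∧ L ε n m ≤ 1} := by
    refine ⟨by omega, L_le_one hε0 hn (by omega) ?_⟩
    rw [Nat.cast_sub (by omega)]
    push_cast
    linarith
  have := le_csSup (bddAbove_row hε hn) hmem
  unfold M
  omega

/-- The square root of the starting index grows by at most `1` from one row to the next. -/
lemma sqrt_add_M_le {ε : ℝ} (hε0 : 0 < ε) (hε : ε < 1 / 2) {n : ℕ} (hn : 1 ≤ n) :
    √((n + M ε n : ℕ) : ℝ) ≤ √(n : ℝ) + 1 := by
  have hne : {m : ℕ | n ≤ m ∧ L ε n m ≤ 1}.Nonempty := by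
    refine ⟨n, le_rfl, L_le_one hε0 hn le_rfl ?_⟩
    have := Real.one_le_rpow (x := (n : ℝ)) (z := (1 + ε) / 3) (by exact_mod_cast hn) (by linarith)
    linarith
  obtain ⟨h1, h2⟩ := Nat.sSup_mem hne (bddAbove_row hε hn)
  have h := card_le_sqrt_of_L_le_one hε hn h1 h2
  have hM : n + M ε n = sSup {m : ℕ | n ≤ m ∧ L ε n m ≤ 1} + 1 := by
    unfold M
    omega
  rw [hM]
  generalize sSup {m : ℕ | n ≤ m ∧ L ε n m ≤ 1} = m at *
  have hmono : √(m : ℝ) ≤ √((m + 1 : ℕ) : ℝ) := Real.sqrt_le_sqrt (by push_cast; linarith)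
  have hsq := Real.sq_sqrt (Nat.cast_nonneg (α := ℝ) (m + 1))
  have hsq' := Real.sq_sqrt (Nat.cast_nonneg (α := ℝ) n)
  have h0 := Real.sqrt_nonneg (n : ℝ)
  push_cast at hsq hmono ⊢
  by_contra! hlt
  nlinarith

lemma B_succ (ε : ℝ) (n : ℕ) {r : ℕ} (hr : 1 ≤ r) :
    B ε n (r + 1) = B ε n r + M ε (B ε n r) := by
  obtain ⟨r, rfl⟩ := Nat.exists_eq_add_of_le' hr
  rfl

lemma le_B_succ {ε : ℝ} (hε0 : 0 < ε) (hε : ε < 1 / 2) {n : ℕ} (hn : 1 ≤ n) (r : ℕ) :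
    n + r * ⌊(n : ℝ) ^ ((1 + ε) / 3)⌋₊ ≤ B ε n (r + 1) := by
  induction r with
  | zero => simp [B]
  | succ r ih =>
    rw [B_succ ε n (by omega)]
    have hle : n ≤ B ε n (r + 1) := le_trans (Nat.le_add_right _ _) ih
    have hM := floor_rpow_le_M hε0 hε (hn.trans hle)
    have hfl : ⌊(n : ℝ) ^ ((1 + ε) / 3)⌋₊ ≤ ⌊(B ε n (r + 1) : ℝ) ^ ((1 + ε) / 3)⌋₊ :=
      Nat.floor_le_floor (Real.rpow_le_rpow (by positivity) (by exact_mod_cast hle) (by linarith))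
    rw [Nat.succ_mul]
    omega

lemma le_B {ε : ℝ} (hε0 : 0 < ε) (hε : ε < 1 / 2) {n : ℕ} (hn : 1 ≤ n) (r : ℕ) :
    n ≤ B ε n r := by
  cases r with
  | zero => exact le_rfl
  | succ r => exact le_trans (Nat.le_add_right _ _) (le_B_succ hε0 hε hn r)

lemma sqrt_B_succ_le {ε : ℝ} (hε0 : 0 < ε) (hε : ε < 1 / 2) {n : ℕ} (hn : 1 ≤ n) (r : ℕ) :
    √(B ε n (r + 1) : ℝ) ≤ √(n : ℝ) + r := by
  induction r with
  | zero => simp [B]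
  | succ r ih =>
    rw [B_succ ε n (by omega)]
    have := sqrt_add_M_le hε0 hε (hn.trans (le_B hε0 hε hn (r + 1)))
    push_cast at this ⊢
    linarith

lemma W_eq_sum_range (ε : ℝ) (n R : ℕ) :
    W ε n R = ∑ i ∈ Finset.range R, sideLen ε (B ε n (i + 1)) := by
  rw [Finset.range_eq_Ico, Finset.sum_Ico_add' (fun i => sideLen ε (B ε n i)) 0 R 1]
  rfl

/-- The widths of the rows are bounded below by a multiple of the harmonic series. -/
lemma harmonic_div_sqrt_le_W {ε : ℝ} (hε0 : 0 < ε) (hε : ε < 1 / 2) {n : ℕ} (hn : 1 ≤ n) (R : ℕ) :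
    (∑ i ∈ Finset.range R, 1 / ((i : ℝ) + 1)) / √(n : ℝ) ≤ W ε n R := by
  have hs : 1 ≤ √(n : ℝ) := Real.one_le_sqrt.2 (by exact_mod_cast hn)
  rw [W_eq_sum_range, Finset.sum_div]
  refine Finset.sum_le_sum fun i _ => ?_
  have hB : 1 ≤ B ε n (i + 1) := hn.trans (le_B hε0 hε hn _)
  refine le_trans ?_ (inv_sqrt_le_sideLen hε hB)
  have hpos : 0 < √(B ε n (i + 1) : ℝ) := Real.sqrt_pos.2 (by exact_mod_cast hB)
  have hle := sqrt_B_succ_le hε0 hε hn i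
  rw [div_div, one_div]
  refine inv_anti₀ hpos (hle.trans ?_)
  nlinarith [Nat.cast_nonneg (α := ℝ) i]

lemma bddAbove_rows {ε : ℝ} (hε0 : 0 < ε) (hε : ε < 1 / 2) {n : ℕ} (hn : 1 ≤ n) :
    BddAbove {R : ℕ | 1 ≤ R ∧ W ε n R ≤ 1} := by
  have hs : 0 < √(n : ℝ) := Real.sqrt_pos.2 (by exact_mod_cast hn)
  obtain ⟨R₀, hR₀⟩ := Filter.eventually_atTop.1
    (Real.tendsto_sum_range_one_div_nat_succ_atTop.eventually_gt_atTop √(n : ℝ))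
  refine ⟨R₀, fun R hR => ?_⟩
  by_contra! hlt
  have h := (harmonic_div_sqrt_le_W hε0 hε hn R).trans hR.2
  rw [div_le_one hs] at h
  exact absurd h (not_le.2 (hR₀ R hlt.le))

lemma floor_rpow_le_Rn {ε : ℝ} (hε0 : 0 < ε) (hε : ε < 1 / 2) {n : ℕ} (hn : 1 ≤ n) :
    ⌊(n : ℝ) ^ ((1 + ε) / 3)⌋₊ ≤ Rn ε n := by
  have hn' : (0 : ℝ) < n := by exact_mod_cast hn
  refine le_csSup (bddAbove_rows hε0 hε hn) ⟨one_le_floor_rpow hε0 hn, ?_⟩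
  rw [W_eq_sum_range]
  refine (Finset.sum_le_card_nsmul _ _ (sideLen ε n) fun i _ =>
    sideLen_anti hε0 hn (le_B hε0 hε hn _)).trans ?_
  rw [Finset.card_range, nsmul_eq_mul, sideLen, neg_div, Real.rpow_neg hn'.le, ← div_eq_mul_inv,
    div_le_one (Real.rpow_pos_of_pos hn' _)]
  exact Nat.floor_le (by positivity)

lemma floor_rpow_sq_le_N {ε : ℝ} (hε0 : 0 < ε) (hε : ε < 1 / 2) {n : ℕ} (hn : 1 ≤ n) :
    ⌊(n : ℝ) ^ ((1 + ε) / 3)⌋₊ ^ 2 ≤ N ε n := by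
  have h1 := le_B_succ hε0 hε hn (Rn ε n)
  have h2 := Nat.mul_le_mul_right ⌊(n : ℝ) ^ ((1 + ε) / 3)⌋₊ (floor_rpow_le_Rn hε0 hε hn)
  rw [sq]
  unfold N
  omega

end CubePacking

open CubePacking in
/-- Lower bound on `N_n`.
There exists `n⋆(ε)` such that `N_n ≥ (1−ε)³ n^{(2+2ε)/3}` for all `n ≥ n⋆(ε)`. -/
theorem N_lower_bound (ε : ℝ) (hε0 : 0 < ε) (hε : ε < 1 / 2) :
    ∃ nst : ℕ, ∀ n : ℕ, nst ≤ n →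
      (1 - ε) ^ 3 * (n : ℝ) ^ ((2 + 2 * ε) / 3) ≤ (N ε n : ℝ) := by
  have htend : Filter.Tendsto (fun n : ℕ => (n : ℝ) ^ ((1 + ε) / 3)) Filter.atTop Filter.atTop :=
    (tendsto_rpow_atTop (by linarith)).comp tendsto_natCast_atTop_atTop
  obtain ⟨n₀, hn₀⟩ := Filter.eventually_atTop.1 (htend.eventually_ge_atTop (1 / ε))
  refine ⟨max n₀ 1, fun n hn => ?_⟩
  have hx := hn₀ n ((le_max_left _ _).trans hn)
  have hN : ((⌊(n : ℝ) ^ ((1 + ε) / 3)⌋₊ : ℝ)) ^ 2 ≤ N ε n := by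
    exact_mod_cast floor_rpow_sq_le_N hε0 hε ((le_max_right _ _).trans hn)
  have hpow : (n : ℝ) ^ ((2 + 2 * ε) / 3) = ((n : ℝ) ^ ((1 + ε) / 3)) ^ 2 := by
    rw [← Real.rpow_mul_natCast (by positivity)]
    congr 1
    push_cast
    ring
  rw [hpow]
  have hfl := Nat.lt_floor_add_one ((n : ℝ) ^ ((1 + ε) / 3))
  generalize (n : ℝ) ^ ((1 + ε) / 3) = x at *
  rw [div_le_iff₀ hε0] at hx
  have hx0 : 0 ≤ x := by nlinarith
  calc (1 - ε) ^ 3 * x ^ 2 ≤ (1 - ε) ^ 2 * x ^ 2 := by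
        gcongr ?_ * _
        exact pow_le_pow_of_le_one (by linarith) (by linarith) (by norm_num)
    _ = ((1 - ε) * x) ^ 2 := by ring
    _ ≤ (⌊x⌋₊ : ℝ) ^ 2 :=
        pow_le_pow_left₀ (mul_nonneg (by linarith) hx0) (by nlinarith) 2
    _ ≤ N ε n := hN
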